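/- Every strong parallelepiped structure can be embedded in a nilparallelepiped structure: if (𝒫,𝒬) is a strong parallelepiped structure on a nonempty set X, then there exist a nilparallelepiped structure (𝒫',𝒬') on a set X' and an injection ι: X → X' such that 𝒫 = (ι^{[2]})⁻¹(𝒫') and 𝒬 = (ι^{[3]})⁻¹(𝒬'), where ι^{[2]} and ι^{[3]} apply ι coordinatewise, and the composition of ι with the projection of X' onto its base is onto. -/

import Mathlib

open scoped Pointwise

namespace HK

/-- Quadruples of elements of `X`, indexed by the vertices `00, 01, 10, 11` of the square. -/
abbrev Quad (X : Type) := X × X × X × X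

/-- Vertices of the cube `{0,1}³`. -/
abbrev Vtx := Fin 3 → Bool

/-- Elements of `X^{[3]} = X⁸`, indexed by the vertices of the cube. -/
abbrev Cube (X : Type) := Vtx → X

variable {X Y : Type}

/-- Apply a map coordinatewise to a quadruple. -/
def map4 (f : X → Y) (p : Quad X) : Quad Y := (f p.1, f p.2.1, f p.2.2.1, f p.2.2.2)

/-- Apply a map coordinatewise to a cube. -/
def mapCube (f : X → Y) (x : Cube X) : Cube Y := fun v => f (x v)

/-- A weak parallelogram structure: the relation `(x00,x01) ∼ (x10,x11) ↔ (x00,x01,x10,x11) ∈ P`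
is an equivalence relation, `P` is invariant under exchanging the two middle entries, and
any three points can be completed to a parallelogram. -/
def IsWeakParallelogram (P : Set (Quad X)) : Prop :=
  (∀ a b : X, (a, b, a, b) ∈ P) ∧
  (∀ a b c d : X, (a, b, c, d) ∈ P → (c, d, a, b) ∈ P) ∧
  (∀ a b c d e f : X, (a, b, c, d) ∈ P → (c, d, e, f) ∈ P → (a, b, e, f) ∈ P) ∧
  (∀ a b c d : X, (a, b, c, d) ∈ P → (a, c, b, d) ∈ P) ∧
  (∀ a b c : X, ∃ d, (a, b, c, d) ∈ P)

/-- A strong parallelogram structure: the completing fourth point is unique. -/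
def IsStrongParallelogram (P : Set (Quad X)) : Prop :=
  IsWeakParallelogram P ∧ ∀ a b c : X, ∃! d, (a, b, c, d) ∈ P

/-- The entry of a quadruple at a vertex of the square. -/
def quadAt (p : Quad X) : Bool → Bool → X
  | false, false => p.1
  | false, true => p.2.1
  | true, false => p.2.2.1
  | true, true => p.2.2.2

/-- The cube whose face `ε₁ = 0` is `p` and whose face `ε₁ = 1` is `q`. -/
def joinQuad (p q : Quad X) : Cube X :=
  fun v => if v 0 = false then quadAt p (v 1) (v 2) else quadAt q (v 1) (v 2)

/-- The vertex of the cube with value `b` at coordinate `i` and values `u,v` at the two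
remaining coordinates, taken in increasing order. -/
def insert3 (i : Fin 3) (b u v : Bool) : Vtx :=
  if i = 0 then ![b, u, v] else if i = 1 then ![u, b, v] else ![u, v, b]

/-- The face `{v : v i = b}` of a cube, as a quadruple in lexicographic order. -/
def face (x : Cube X) (i : Fin 3) (b : Bool) : Quad X :=
  (x (insert3 i b false false), x (insert3 i b false true),
   x (insert3 i b true false), x (insert3 i b true true))

/-- The permutations of the vertices of the cube induced by Euclidean isometries of the unit
cube: a permutation of the three coordinates composed with flips of some coordinates. -/
def cubeSym (σ : Equiv.Perm (Fin 3)) (c : Vtx) (v : Vtx) : Vtx :=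
  fun j => xor (v (σ j)) (c j)

/-- A weak parallelepiped structure `(P, Q)`: every face of an element of `Q` lies in `P`;
`Q` is invariant under the Euclidean permutations of the cube; the relation `≈` on `P`
(`p ≈ q ↔ joinQuad p q ∈ Q`) is an equivalence relation; and seven points whose three
determined faces lie in `P` can be completed to an element of `Q`. -/
def IsWeakParallelepiped (P : Set (Quad X)) (Q : Set (Cube X)) : Prop :=
  IsWeakParallelogram P ∧
  (∀ x ∈ Q, ∀ (i : Fin 3) (b : Bool), face x i b ∈ P) ∧
  (∀ (σ : Equiv.Perm (Fin 3)) (c : Vtx), ∀ x ∈ Q, (fun v => x (cubeSym σ c v)) ∈ Q) ∧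
  (∀ p ∈ P, joinQuad p p ∈ Q) ∧
  (∀ p q : Quad X, joinQuad p q ∈ Q → joinQuad q p ∈ Q) ∧
  (∀ p q r : Quad X, joinQuad p q ∈ Q → joinQuad q r ∈ Q → joinQuad p r ∈ Q) ∧
  (∀ x000 x001 x010 x011 x100 x101 x110 : X,
    (x000, x001, x010, x011) ∈ P → (x000, x010, x100, x110) ∈ P →
    (x000, x001, x100, x101) ∈ P →
    ∃ x111, joinQuad (x000, x001, x010, x011) (x100, x101, x110, x111) ∈ Q)

/-- A strong parallelepiped structure: the completing eighth point is unique. -/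
def IsStrongParallelepiped (P : Set (Quad X)) (Q : Set (Cube X)) : Prop :=
  IsWeakParallelepiped P Q ∧
  ∀ x000 x001 x010 x011 x100 x101 x110 : X,
    (x000, x001, x010, x011) ∈ P → (x000, x010, x100, x110) ∈ P →
    (x000, x001, x100, x101) ∈ P →
    ∃! x111, joinQuad (x000, x001, x010, x011) (x100, x101, x110, x111) ∈ Q

/-- The setoid on `X²` given by the parallelogram relation `∼`. -/
def baseSetoid (P : Set (Quad X)) (hP : IsWeakParallelogram P) : Setoid (X × X) where
  r p q := (p.1, p.2, q.1, q.2) ∈ P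
  iseqv := ⟨fun p => hP.1 p.1 p.2,
            fun h => hP.2.1 _ _ _ _ h,
            fun h h' => hP.2.2.1 _ _ _ _ _ _ h h'⟩

/-- The base `B = X²/∼` of a weak parallelogram structure. -/
def Base (P : Set (Quad X)) (hP : IsWeakParallelogram P) : Type := Quotient (baseSetoid P hP)

/-- The class `⟨x,y⟩ ∈ B` of a pair `(x,y)`. -/
def cls (P : Set (Quad X)) (hP : IsWeakParallelogram P) (x y : X) : Base P hP :=
  Quotient.mk (baseSetoid P hP) (x, y)

/-- The Gowers-type sum over parallelograms attached to a finitely supported `f : X → ℂ`. -/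
noncomputable def gSum2 (P : Set (Quad X)) (f : X →₀ ℂ) : ℂ :=
  ∑ᶠ q ∈ P, f q.1 * (starRingEnd ℂ) (f q.2.1) * (starRingEnd ℂ) (f q.2.2.1) * f q.2.2.2

/-- The seminorm `‖f‖_P = (gSum2 P f)^{1/4}`. -/
noncomputable def pNorm (P : Set (Quad X)) (f : X →₀ ℂ) : ℝ :=
  (gSum2 P f).re ^ ((1 : ℝ) / 4)

/-- `C^{|ε|} z`: conjugate `z` when the vertex `v` has an odd number of `1` entries. -/
noncomputable def cConjFactor (v : Vtx) (z : ℂ) : ℂ :=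
  if xor (v 0) (xor (v 1) (v 2)) then (starRingEnd ℂ) z else z

/-- The Gowers-type sum over parallelepipeds attached to a finitely supported `f : X → ℂ`. -/
noncomputable def gSum3 (Q : Set (Cube X)) (f : X →₀ ℂ) : ℂ :=
  ∑ᶠ x ∈ Q, ∏ v : Vtx, cConjFactor v (f (x v))

/-- The seminorm `‖f‖_Q = (gSum3 Q f)^{1/8}`. -/
noncomputable def qNorm (Q : Set (Cube X)) (f : X →₀ ℂ) : ℝ :=
  (gSum3 Q f).re ^ ((1 : ℝ) / 8)

/-- The structure group of a parallelepiped structure, as a set of bijections of `X`: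
those `g` mapping every parallelogram to an equivalent parallelogram. -/
def structSet (P : Set (Quad X)) (Q : Set (Cube X)) : Set (Equiv.Perm X) :=
  {g | ∀ p ∈ P, map4 g p ∈ P ∧ joinQuad (map4 g p) p ∈ Q}

/-- `x` and `y` lie in the same fiber of `π : X → B`, `π(x) = ⟨i,x⟩`. -/
def sameFiber (P : Set (Quad X)) (i x y : X) : Prop := (i, x, i, y) ∈ P

/-- A vertical quadruple: all four points lie in one fiber. -/
def VerticalQ (P : Set (Quad X)) (i : X) (w : Quad X) : Prop :=
  sameFiber P i w.1 w.2.1 ∧ sameFiber P i w.2.1 w.2.2.1 ∧ sameFiber P i w.2.2.1 w.2.2.2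

/-- `y = u·x` where `u = [w]` is the class of the vertical parallelogram `w`:
`(x,x,x,y)` is a parallelogram equivalent to `w`. -/
def actsRel (P : Set (Quad X)) (Q : Set (Cube X)) (w : Quad X) (x y : X) : Prop :=
  (x, x, x, y) ∈ P ∧ joinQuad (x, x, x, y) w ∈ Q

section Groups

variable (G : Type) [Group G]

/-- The diagonal embedding `G → G^{[2]}`. -/
def diagHom2 : G →* Quad G where
  toFun g := (g, g, g, g)
  map_one' := rfl
  map_mul' _ _ := rfl

/-- The diagonal embedding `G → G^{[3]}`. -/
def diagHom3 : G →* Cube G where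
  toFun g := fun _ => g
  map_one' := rfl
  map_mul' _ _ := rfl

/-- The two dimensional edge group `G^{[2,1]}`. -/
def edgeGroup2 : Subgroup (Quad G) :=
  Subgroup.closure
    {q : Quad G | ∃ g : G, q = (g, g, 1, 1) ∨ q = (g, 1, g, 1) ∨ q = (g, g, g, g)}

/-- The second commutator subgroup `G₃ = [G, G₂]`. -/
def secondCommutator : Subgroup G := ⁅(⊤ : Subgroup G), commutator G⁆

variable {G}

/-- The edge group `F^{[2,1]}` of a subgroup `F ≤ G`, inside `G^{[2]}`. -/
def edgeGroup2Of (F : Subgroup G) : Subgroup (Quad G) :=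
  Subgroup.closure
    {q : Quad G | ∃ u ∈ F, q = (u, u, 1, 1) ∨ q = (u, 1, u, 1) ∨ q = (u, u, u, u)}

/-- `F^{[2]} = F⁴` as a subgroup of `G^{[2]}`. -/
def quadSub (F : Subgroup G) : Subgroup (Quad G) := F.prod (F.prod (F.prod F))

/-- Faces of the cube `{0,1}³`. -/
def IsFace3 (α : Set Vtx) : Prop := ∃ (i : Fin 3) (b : Bool), α = {v : Vtx | v i = b}

/-- Edges of the cube `{0,1}³`. -/
def IsEdge3 (α : Set Vtx) : Prop :=
  ∃ (i j : Fin 3) (b c : Bool), i ≠ j ∧ α = {v : Vtx | v i = b ∧ v j = c}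

open Classical in
/-- The element `g^{[3,α]}` of `G^{[3]}`, with coordinate `g` on `α` and `1` elsewhere. -/
noncomputable def cubeElt (α : Set Vtx) (g : G) : Cube G :=
  fun v => if v ∈ α then g else 1

variable (G)

/-- The face group `G^{[3,2]}`, generated by the `g^{[3,f]}` for faces `f` of the cube. -/
noncomputable def faceGroup : Subgroup (Cube G) :=
  Subgroup.closure {x : Cube G | ∃ (g : G) (α : Set Vtx), IsFace3 α ∧ x = cubeElt α g}

variable {G}

/-- The edge group `F^{[3,1]}` of a subgroup `F ≤ G`, generated by the `u^{[3,e]}` for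
`u ∈ F` and edges `e` of the cube. -/
noncomputable def edgeGroup3 (F : Subgroup G) : Subgroup (Cube G) :=
  Subgroup.closure {x : Cube G | ∃ u ∈ F, ∃ α : Set Vtx, IsEdge3 α ∧ x = cubeElt α u}

end Groups

/-- The data realizing `(PY, QY)` as the nilparallelepiped structure associated to
`G`, `F`, `Γ` via the coset projection `p : G → Y ≅ G/Γ`. -/
def NilWitness (G : Type) [Group G] (F Γ : Subgroup G) {Y : Type} (p : G → Y)
    (PY : Set (Quad Y)) (QY : Set (Cube Y)) : Prop :=
  commutator G ≤ F ∧ F ≤ Subgroup.center G ∧ Γ ⊓ F = ⊥ ∧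
  Function.Surjective p ∧ (∀ g g' : G, p g = p g' ↔ g⁻¹ * g' ∈ Γ) ∧
  PY = map4 p '' ((edgeGroup2 G : Set (Quad G)) * (quadSub F : Set (Quad G))) ∧
  QY = mapCube p '' ((faceGroup G : Set (Cube G)) * (edgeGroup3 F : Set (Cube G)))

/-- `(PY, QY)` is a nilparallelepiped structure. -/
def IsNilStructure {Y : Type} (PY : Set (Quad Y)) (QY : Set (Cube Y)) : Prop :=
  ∃ (G : Type) (inst : Group G) (F Γ : @Subgroup G inst) (p : G → Y),
    @NilWitness G inst F Γ Y p PY QY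

/-- A splitting of the exact sequence `0 → F → P_s → B → 0` for `s = ⟨a₀, b₀⟩`, encoded
by a lift `ψ : X → 𝒫_s` of a homomorphism section `φ : B → P_s` of `q_s`:
`ψ x` is a parallelogram in `𝒫_s` representing the class `φ(π(x))`. -/
def IsSplittingAt (P : Set (Quad X)) (Q : Set (Cube X)) (i a₀ b₀ : X) : Prop :=
  ∃ ψ : X → Quad X,
    (∀ x, ψ x ∈ P) ∧
    (∀ x, (a₀, b₀, (ψ x).1, (ψ x).2.1) ∈ P) ∧
    (∀ x, ((ψ x).1, (ψ x).2.2.1, i, x) ∈ P) ∧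
    (∀ x y, (i, x, i, y) ∈ P → joinQuad (ψ x) (ψ y) ∈ Q) ∧
    (∀ x1 x2 x3, (x1, x3, i, x2) ∈ P →
      ∃ c d, joinQuad ((ψ x1).2.2.1, (ψ x1).2.2.2, c, d) (ψ x2) ∈ Q ∧
        joinQuad ((ψ x1).1, (ψ x1).2.1, c, d) (ψ x3) ∈ Q)

/-- `(B, c)` is a realization of the base group of the parallelogram structure `P`,
`c x y` realizing the class `⟨x,y⟩`. -/
def IsBaseRealization (P : Set (Quad X)) (B : Type) [AddCommGroup B] (c : X → X → B) : Prop :=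
  (Function.Surjective fun p : X × X => c p.1 p.2) ∧
  (∀ a b a' b' : X, c a b = c a' b' ↔ (a, b, a', b') ∈ P) ∧
  (∀ a b d : X, c a b + c b d = c a d)

/-- `(F, fl)` is a realization of the fiber group of the parallelepiped structure `(P, Q)`:
`fl` maps vertical parallelograms onto `F`, separates exactly the `≈`-classes, and is
additive with respect to the composition of vertical parallelograms. -/
def IsFiberRealization (P : Set (Quad X)) (Q : Set (Cube X)) (i : X) (F : Type)
    [AddCommGroup F] (fl : Quad X → F) : Prop :=
  (∀ u : F, ∃ w, VerticalQ P i w ∧ fl w = u) ∧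
  (∀ w w' : Quad X, VerticalQ P i w → VerticalQ P i w' →
    (fl w = fl w' ↔ joinQuad w w' ∈ Q)) ∧
  (∀ x0 x1 x2 x3 x4 x5 : X, sameFiber P i x0 x1 → sameFiber P i x1 x2 →
    sameFiber P i x2 x3 → sameFiber P i x3 x4 → sameFiber P i x4 x5 →
    fl (x0, x1, x2, x3) + fl (x2, x3, x4, x5) = fl (x0, x1, x4, x5))

/-- A divisible (equivalently, injective) abelian group. -/
def IsDivisibleGroup (F : Type) [AddCommGroup F] : Prop :=
  ∀ (u : F) (n : ℕ), 0 < n → ∃ v : F, n • v = u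

/-- A projective abelian group (projective as a `ℤ`-module). -/
def IsProjectiveAdd (B : Type) [AddCommGroup B] : Prop := Module.Projective ℤ B

/-- A weak parallelogram structure is the pullback of the parallelograms of an abelian group. -/
theorem IsWeakParallelogram.exists_base [Nonempty X] {P : Set (Quad X)}
    (hP : IsWeakParallelogram P) :
    ∃ (B : Type) (_ : AddCommGroup B) (π : X → B), Function.Surjective π ∧
      ∀ a b c d, (a, b, c, d) ∈ P ↔ π a + π d = π b + π c := by
  obtain ⟨hrefl, hsymm, htrans, hswap, hcomplete⟩ := hP
  obtain ⟨i⟩ := ‹Nonempty X›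
  have hdiag : ∀ a b, (a, a, b, b) ∈ P := fun a b => hswap _ _ _ _ (hrefl a b)
  let S : Setoid X :=
    { r := fun x y => (i, i, x, y) ∈ P
      iseqv :=
        ⟨fun x => hdiag i x,
        fun {x y} h => hswap _ _ _ _ (hsymm _ _ _ _ (hswap _ _ _ _ h)),
        fun {x y z} h h' => hswap _ _ _ _
          (htrans _ _ _ _ _ _ (hswap _ _ _ _ h) (hswap _ _ _ _ h'))⟩ }
  have hrel : ∀ x y c, (c, c, x, y) ∈ P → S x y := fun x y c h =>
    htrans _ _ _ _ _ _ (hdiag i c) h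
  have huniq : ∀ a b c d d', (a, b, c, d) ∈ P → (a, b, c, d') ∈ P → S d d' :=
    fun a b c d d' h h' =>
      hrel _ _ _ (hswap _ _ _ _ (htrans _ _ _ _ _ _ (hsymm _ _ _ _ h) h'))
  have hlast : ∀ a b c d d', (a, b, c, d) ∈ P → S d d' → (a, b, c, d') ∈ P := by
    intro a b c d d' h h'
    have h1 : (i, i, d, d') ∈ P := h'
    exact htrans _ _ _ _ _ _ h (hswap _ _ _ _ (htrans _ _ _ _ _ _ (hdiag c i) h1))
  have hsec : ∀ a b c c' d, (a, b, c, d) ∈ P → S c c' → (a, b, c', d) ∈ P := by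
    intro a b c c' d h h'
    have h1 : (i, i, c, c') ∈ P := h'
    have h2 : (c, d, c', d) ∈ P :=
      hswap _ _ _ _ (htrans _ _ _ _ _ _ (hsymm _ _ _ _ h1) (hdiag i d))
    exact htrans _ _ _ _ _ _ h h2
  choose m hm using fun x y => hcomplete i x y
  choose n hn using fun x => hcomplete x i i
  have hmul : ∀ x x' y y', S x x' → S y y' → S (m x y) (m x' y') := by
    intro x x' y y' hx hy
    refine huniq i x' y' _ _ ?_ (hm x' y')
    exact hswap _ _ _ _ (hsec _ _ _ _ _ (hswap _ _ _ _ (hsec _ _ _ _ _ (hm x y) hy)) hx)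
  have hcommut : ∀ x y z w y'' x', (x, y, x', w) ∈ P → (y, z, y'', x') ∈ P →
      (x, z, y'', w) ∈ P := by
    intro x y z w y'' x' h h'
    obtain ⟨t, ht⟩ := hcomplete y z w
    have h1 : (x, z, x', t) ∈ P := hswap _ _ _ _
      (htrans _ _ _ _ _ _ (hswap _ _ _ _ h) (hswap _ _ _ _ ht))
    have h2 : (y'', x', w, t) ∈ P := htrans _ _ _ _ _ _ (hsymm _ _ _ _ h') ht
    exact htrans _ _ _ _ _ _ h1 (hsymm _ _ _ _ (hswap _ _ _ _ h2))
  let B := Quotient S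
  let addB : B → B → B := Quotient.map₂ m fun x x' hx y y' hy => hmul x x' y y' hx hy
  have hcomm : ∀ u v, addB u v = addB v u := by
    rintro ⟨x⟩ ⟨y⟩
    exact Quotient.sound (huniq _ _ _ _ _ (hm x y) (hswap _ _ _ _ (hm y x)))
  have hassoc : ∀ u v w, addB (addB u v) w = addB u (addB v w) := by
    rintro ⟨x⟩ ⟨y⟩ ⟨z⟩
    refine Quotient.sound (huniq i x (m y z) _ _ ?_ (hm x (m y z)))
    have h1 : (y, m y z, m x y, m (m x y) z) ∈ P :=
      htrans _ _ _ _ _ _ (hsymm _ _ _ _ (hswap _ _ _ _ (hm y z))) (hswap _ _ _ _ (hm (m x y) z))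
    exact htrans _ _ _ _ _ _ (hm x y) (hswap _ _ _ _ h1)
  have hnegS : ∀ x, S (m (n x) x) i := fun x =>
    huniq i (n x) x _ _ (hm _ _) (hsymm _ _ _ _ (hswap _ _ _ _ (hn x)))
  have hnegc : ∀ x x', S x x' → S (n x) (n x') := by
    intro x x' h
    have h1 : (i, n x, x', i) ∈ P :=
      hsec _ _ _ _ _ (hsymm _ _ _ _ (hswap _ _ _ _ (hn x))) h
    exact huniq x' i i _ _ (hswap _ _ _ _ (hsymm _ _ _ _ h1)) (hn x')
  let negB : B → B := Quotient.map n fun x x' h => hnegc x x' h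
  have hzero : ∀ u, addB (Quotient.mk S i) u = u := by
    rintro ⟨x⟩
    exact Quotient.sound (huniq i i x _ _ (hm i x) (hdiag i x))
  have hneg : ∀ u, addB (negB u) u = Quotient.mk S i := by
    rintro ⟨x⟩
    exact Quotient.sound (hnegS x)
  let : Add B := ⟨addB⟩
  let : Neg B := ⟨negB⟩
  let : Zero B := ⟨Quotient.mk S i⟩
  let G : AddGroup B := AddGroup.ofLeftAxioms hassoc hzero hneg
  let GC : AddCommGroup B := { G with add_comm := hcomm }
  have key : ∀ a b c d, (a, b, c, d) ∈ P →
      (Quotient.mk S a : B) + Quotient.mk S d = Quotient.mk S b + Quotient.mk S c := by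
    intro a b c d h
    refine Quotient.sound (huniq i b c _ _ ?_ (hm b c))
    have h1 : (i, d, a, m a d) ∈ P := hswap _ _ _ _ (hm a d)
    have h2 : (d, c, b, a) ∈ P :=
      hswap _ _ _ _ (hsymm _ _ _ _ (hswap _ _ _ _ (hsymm _ _ _ _ h)))
    exact hswap _ _ _ _ (hcommut _ _ _ _ _ _ h1 h2)
  refine ⟨B, GC, Quotient.mk S, Quotient.mk_surjective, fun a b c d => ⟨key a b c d, fun h => ?_⟩⟩
  obtain ⟨d', hd'⟩ := hcomplete a b c
  have h1 := key _ _ _ _ hd'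
  rw [← h] at h1
  exact hlast _ _ _ _ _ hd' (Quotient.exact (add_left_cancel h1))

/-- Every abelian group embeds in one that splits off every abelian group containing it. -/
theorem exists_embedding_split (A : Type) [AddCommGroup A] :
    ∃ (D : Type) (_ : AddCommGroup D) (j : A →+ D), Function.Injective j ∧
      ∀ (E : Type) [AddCommGroup E] (k : D →+ E), Function.Injective k →
        ∃ r : E →+ D, ∀ d, r (k d) = d := by
  open CategoryTheory in
  let D := Injective.under (AddCommGrpCat.of A)
  refine ⟨D, inferInstance, (CategoryTheory.Injective.ι (AddCommGrpCat.of A)).hom,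
    (AddCommGrpCat.mono_iff_injective _).mp inferInstance, fun E _ k hk => ?_⟩
  let i : D ⟶ AddCommGrpCat.of E := AddCommGrpCat.ofHom k
  have : CategoryTheory.Mono i := (AddCommGrpCat.mono_iff_injective _).mpr hk
  refine ⟨(CategoryTheory.Injective.factorThru (CategoryTheory.CategoryStruct.id D) i).hom,
    fun d => ?_⟩
  exact congrArg (fun t => t.hom d)
    (CategoryTheory.Injective.comp_factorThru (CategoryTheory.CategoryStruct.id D) i)

/-- The underlying set of an extension of `B` by `D`. -/
@[ext]
structure TwistedSum (B D : Type) where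
  fst : B
  snd : D

/-- A symmetric family satisfying the additivity rule for second differences, with values in a
group that splits off every group containing it, is the second difference of a function. -/
theorem exists_second_difference {B D : Type} [AddCommGroup B] [AddCommGroup D]
    (hD : ∀ (E : Type) [AddCommGroup E] (k : D →+ E), Function.Injective k →
      ∃ r : E →+ D, ∀ d, r (k d) = d)
    (τ : B → B → B → D) (hsymm : ∀ b h k, τ b h k = τ b k h)
    (hadd : ∀ b h h' k, τ b (h + h') k = τ b h k + τ (b + h) h' k) :
    ∃ φ : B → D, ∀ b h k, φ b - φ (b + h) - φ (b + k) + φ (b + h + k) = τ b h k := by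
  have hzero : ∀ b k, τ b 0 k = 0 := fun b k => by simpa using hadd b 0 0 k
  have hzero' : ∀ b k, τ b k 0 = 0 := fun b k => by rw [hsymm, hzero]
  have hadd' : ∀ b h k k', τ b h (k + k') = τ b h k + τ (b + k) h k' := fun b h k k' => by
    rw [hsymm, hadd, hsymm b, hsymm (b + k)]
  let E := TwistedSum B D
  let : Add E := ⟨fun u v => ⟨u.1 + v.1, u.2 + v.2 + τ 0 u.1 v.1⟩⟩
  let : Zero E := ⟨⟨0, 0⟩⟩
  let : Neg E := ⟨fun u => ⟨-u.1, -u.2 - τ 0 (-u.1) u.1⟩⟩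
  have hassoc : ∀ u v w : E, u + v + w = u + (v + w) := by
    intro u v w
    refine TwistedSum.ext (add_assoc _ _ _) ?_
    change u.2 + v.2 + τ 0 u.1 v.1 + w.2 + τ 0 (u.1 + v.1) w.1
      = u.2 + (v.2 + w.2 + τ 0 v.1 w.1) + τ 0 u.1 (v.1 + w.1)
    have h1 := hadd 0 v.1 u.1 w.1
    have h2 := hadd' 0 u.1 v.1 w.1
    rw [add_comm v.1] at h1
    rw [h1, h2]
    abel
  have hz : ∀ u : E, 0 + u = u := by
    intro u
    refine TwistedSum.ext (zero_add _) ?_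
    change 0 + u.2 + τ 0 0 u.1 = u.2
    simp [hzero]
  have hn : ∀ u : E, -u + u = 0 := by
    intro u
    refine TwistedSum.ext (neg_add_cancel _) ?_
    change -u.2 - τ 0 (-u.1) u.1 + u.2 + τ 0 (-u.1) u.1 = 0
    abel
  have hc : ∀ u v : E, u + v = v + u := by
    intro u v
    refine TwistedSum.ext (add_comm _ _) ?_
    change u.2 + v.2 + τ 0 u.1 v.1 = v.2 + u.2 + τ 0 v.1 u.1
    rw [hsymm, add_comm u.2]
  let G : AddGroup E := AddGroup.ofLeftAxioms hassoc hz hn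
  let : AddCommGroup E := { G with add_comm := hc }
  let k : D →+ E := AddMonoidHom.mk' (fun d => ⟨0, d⟩) (by
    intro c d
    refine TwistedSum.ext (add_zero _).symm ?_
    change c + d = c + d + τ 0 0 0
    simp [hzero])
  obtain ⟨r, hr⟩ := hD E k fun c d h => congrArg TwistedSum.snd h
  have hmain : ∀ h l, r ⟨h, 0⟩ + r ⟨l, 0⟩ = r ⟨h + l, 0⟩ + τ 0 h l := by
    intro h l
    conv_rhs => rw [← hr (τ 0 h l)]
    rw [← map_add, ← map_add]
    congr 1
    refine TwistedSum.ext (add_zero _).symm ?_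
    change 0 + 0 + τ 0 h l = 0 + τ 0 h l + τ 0 (h + l) 0
    simp [hzero']
  refine ⟨fun b => -r ⟨b, 0⟩, fun b h l => ?_⟩
  have h1 := hmain b l
  have h2 := hmain (b + h) l
  have h3 := hadd 0 b h l
  rw [zero_add] at h3
  rw [h3] at h2
  beta_reduce
  linear_combination (norm := abel) h2 - h1

/-- Membership in a set of cubes, with the eight vertices in lexicographic order. -/
def MemCube (Q : Set (Cube X)) (a b c d e f g h : X) : Prop :=
  joinQuad (a, b, c, d) (e, f, g, h) ∈ Q

theorem eq_joinQuad (x : Cube X) : x = joinQuad (face x 0 false) (face x 0 true) := by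
  have key : ∀ p q r, x ![p, q, r] = joinQuad (face x 0 false) (face x 0 true) ![p, q, r] := by
    rintro (_ | _) (_ | _) (_ | _) <;> rfl
  funext v
  rw [show v = ![v 0, v 1, v 2] by ext i; fin_cases i <;> rfl]
  exact key _ _ _

namespace IsWeakParallelepiped

variable {P : Set (Quad X)} {Q : Set (Cube X)}

theorem swap_first (hQ : IsWeakParallelepiped P Q) {a b c d e f g h : X}
    (H : MemCube Q a b c d e f g h) : MemCube Q a b e f c d g h := by
  have := hQ.2.2.1 (Equiv.swap 0 1) (fun _ => false) _ H
  rw [eq_joinQuad fun v => _] at this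
  exact this

theorem swap_last (hQ : IsWeakParallelepiped P Q) {a b c d e f g h : X}
    (H : MemCube Q a b c d e f g h) : MemCube Q a c b d e g f h := by
  have := hQ.2.2.1 (Equiv.swap 1 2) (fun _ => false) _ H
  rw [eq_joinQuad fun v => _] at this
  exact this

theorem faces (hQ : IsWeakParallelepiped P Q) {a b c d e f g h : X}
    (H : MemCube Q a b c d e f g h) :
    (a, b, c, d) ∈ P ∧ (e, f, g, h) ∈ P ∧ (a, b, e, f) ∈ P ∧ (a, c, e, g) ∈ P :=
  ⟨hQ.2.1 _ H 0 false, hQ.2.1 _ H 0 true, hQ.2.1 _ H 1 false, hQ.2.1 _ H 2 false⟩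

theorem memCube_self (hQ : IsWeakParallelepiped P Q) {a b c d : X} (H : (a, b, c, d) ∈ P) :
    MemCube Q a b c d a b c d :=
  hQ.2.2.2.1 _ H

theorem memCube_symm (hQ : IsWeakParallelepiped P Q) {a b c d e f g h : X}
    (H : MemCube Q a b c d e f g h) : MemCube Q e f g h a b c d :=
  hQ.2.2.2.2.1 _ _ H

theorem memCube_trans (hQ : IsWeakParallelepiped P Q) {a b c d e f g h e' f' g' h' : X}
    (H : MemCube Q a b c d e f g h) (K : MemCube Q e f g h e' f' g' h') :
    MemCube Q a b c d e' f' g' h' :=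
  hQ.2.2.2.2.2.1 _ _ _ H K

/-- Gluing of cubes along the second direction. -/
theorem memCube_trans_second (hQ : IsWeakParallelepiped P Q)
    {a b c d e f g h c' d' g' h' : X} (H : MemCube Q a b c d e f g h)
    (H' : MemCube Q c d c' d' g h g' h') : MemCube Q a b c' d' e f g' h' :=
  hQ.swap_first (hQ.memCube_trans (hQ.swap_first H) (hQ.swap_first H'))

theorem memCube_symm_second (hQ : IsWeakParallelepiped P Q)
    {a b c d e f g h : X} (H : MemCube Q a b c d e f g h) : MemCube Q c d a b g h e f :=
  hQ.swap_first (hQ.memCube_symm (hQ.swap_first H))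

end IsWeakParallelepiped

/-- `d` measures the difference of two points of the same fiber of `π`, compatibly with the
cubes in `Q` that have a direction along the fibers. -/
structure IsVerticalDifference {B A : Type} [AddCommGroup A] (P : Set (Quad X))
    (Q : Set (Cube X)) (π : X → B) (d : X → X → A) : Prop where
  add : ∀ {a b c}, π a = π b → π b = π c → d a b + d b c = d a c
  inj : ∀ {a b b'}, π a = π b → π a = π b' → d a b = d a b' → b = b'
  memCube_iff : ∀ {a b c e a' b' c' e'}, π a = π a' → π b = π b' → π c = π c' → π e = π e' →
    (a, b, c, e) ∈ P →
    (MemCube Q a b c e a' b' c' e' ↔ d a a' + d e e' = d b b' + d c c')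

theorem exists_isVerticalDifference [Nonempty X] {P : Set (Quad X)} {Q : Set (Cube X)}
    (hS : IsStrongParallelepiped P Q) {B : Type} [AddCommGroup B] (π : X → B)
    (hπ : ∀ a b c d, (a, b, c, d) ∈ P ↔ π a + π d = π b + π c) :
    ∃ (A : Type) (_ : AddCommGroup A) (d : X → X → A), IsVerticalDifference P Q π d := by
  obtain ⟨hQ, huniq⟩ := hS
  let V := {e : X × X // π e.1 = π e.2}
  let P₀ : Set (Quad V) := {q | MemCube Q q.1.1.1 q.2.1.1.1 q.2.2.1.1.1 q.2.2.2.1.1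
    q.1.1.2 q.2.1.1.2 q.2.2.1.1.2 q.2.2.2.1.2}
  have hP₀ : IsWeakParallelogram P₀ := by
    refine ⟨?_, ?_, ?_, ?_, ?_⟩
    · rintro ⟨⟨a, a'⟩, ha⟩ ⟨⟨b, b'⟩, hb⟩
      refine hQ.swap_first (hQ.memCube_self ((hπ _ _ _ _).mpr ?_))
      simp only at ha hb
      rw [ha, hb, add_comm]
    · exact fun a b c d H => hQ.memCube_symm_second H
    · exact fun a b c d e f H H' => hQ.memCube_trans_second H H'
    · exact fun a b c d H => hQ.swap_last H
    · rintro ⟨⟨a, a'⟩, ha⟩ ⟨⟨b, b'⟩, hb⟩ ⟨⟨c, c'⟩, hc⟩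
      simp only at ha hb hc
      obtain ⟨e, he⟩ := hQ.1.2.2.2.2 a b c
      obtain ⟨e', he'⟩ := hQ.2.2.2.2.2.2 a b c e a' b' c' he
        ((hπ _ _ _ _).mpr (by rw [ha, hc, add_comm])) ((hπ _ _ _ _).mpr (by rw [ha, hb, add_comm]))
      refine ⟨⟨(e, e'), ?_⟩, he'⟩
      have h1 := (hπ _ _ _ _).mp he
      have h2 := (hπ _ _ _ _).mp (hQ.faces he').2.1
      rw [← ha, ← hb, ← hc, ← h1] at h2
      exact (add_left_cancel h2).symm
  have : Nonempty V := ‹Nonempty X›.map fun x => ⟨(x, x), rfl⟩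
  obtain ⟨A, instA, δ, -, hδ⟩ := hP₀.exists_base
  classical
  let D : X → X → A := fun a b => if h : π a = π b then δ ⟨(a, b), h⟩ else 0
  have hD : ∀ {a b c e a' b' c' e'}, π a = π a' → π b = π b' → π c = π c' → π e = π e' →
      (MemCube Q a b c e a' b' c' e' ↔ D a a' + D e e' = D b b' + D c c') := by
    intro a b c e a' b' c' e' ha hb hc he
    simp only [D, dif_pos ha, dif_pos hb, dif_pos hc, dif_pos he]
    exact hδ ⟨(a, a'), ha⟩ ⟨(b, b'), hb⟩ ⟨(c, c'), hc⟩ ⟨(e, e'), he⟩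
  have hvert : ∀ {a b c e}, π a = π b → π c = π e → (a, b, c, e) ∈ P := fun h h' =>
    (hπ _ _ _ _).mpr (by rw [h, h'])
  refine ⟨A, instA, fun a b => D a b - D a a, ?_, ?_, ?_⟩
  · intro a b c hab hbc
    have h1 : MemCube Q a a b b b b b b :=
      hQ.swap_last (hQ.swap_first (hQ.memCube_self (hvert hab rfl)))
    have h2 : MemCube Q b b b b b c b c := hQ.swap_first (hQ.memCube_self (hvert rfl hbc))
    have h3 := (hD hab (hab.trans hbc) rfl hbc).mp (hQ.memCube_trans h1 h2)
    linear_combination (norm := abel) h3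
  · intro a b b' hb hb' heq
    have h1 : MemCube Q a a a a b b b b' :=
      (hD hb hb hb hb').mpr (by rw [sub_left_inj.mp heq])
    have h2 : MemCube Q a a a a b b b b :=
      (hD hb hb hb hb).mpr rfl
    have hP : ∀ {a b}, (a, a, b, b) ∈ P := (hvert rfl rfl)
    exact (huniq a a a a b b b hP hP hP).unique h2 h1
  · intro a b c e a' b' c' e' ha hb hc he hp
    rw [hD ha hb hc he]
    have h1 := (hD rfl rfl rfl rfl).mp (hQ.memCube_self hp)
    constructor <;> intro h2
    · linear_combination (norm := abel) h2 - h1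
    · linear_combination (norm := abel) h2 + h1

/-- Two cubes with the same image in the base differ by fiber elements of vanishing
alternating sum. -/
theorem IsVerticalDifference.sum_eq_zero {B A : Type} [AddCommGroup B] [AddCommGroup A]
    {P : Set (Quad X)} {Q : Set (Cube X)} {π : X → B} {d : X → X → A}
    (hd : IsVerticalDifference P Q π d) (hQ : IsWeakParallelepiped P Q)
    (hπ : ∀ a b c d, (a, b, c, d) ∈ P ↔ π a + π d = π b + π c)
    {x₀ x₁ x₂ x₃ x₄ x₅ x₆ x₇ y₀ y₁ y₂ y₃ y₄ y₅ y₆ y₇ : X}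
    (hx : MemCube Q x₀ x₁ x₂ x₃ x₄ x₅ x₆ x₇) (hy : MemCube Q y₀ y₁ y₂ y₃ y₄ y₅ y₆ y₇)
    (h₀ : π x₀ = π y₀) (h₁ : π x₁ = π y₁) (h₂ : π x₂ = π y₂) (h₃ : π x₃ = π y₃)
    (h₄ : π x₄ = π y₄) (h₅ : π x₅ = π y₅) (h₆ : π x₆ = π y₆) (h₇ : π x₇ = π y₇) :
    d x₀ y₀ - d x₁ y₁ - d x₂ y₂ + d x₃ y₃ - d x₄ y₄ + d x₅ y₅ + d x₆ y₆ - d x₇ y₇ = 0 := by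
  have hfill : ∀ {a b c e a' b' c' e' : X}, (a, b, c, e) ∈ P → (a', b', c', e') ∈ P →
      π a = π a' → π b = π b' → π c = π c' →
      ∃ z, π e' = π z ∧ MemCube Q a b c e a' b' c' z := by
    intro a b c e a' b' c' e' hp hp' ha hb hc
    obtain ⟨z, hz⟩ := hQ.2.2.2.2.2.2 a b c e a' b' c' hp
      ((hπ _ _ _ _).mpr (by rw [ha, hc, add_comm])) ((hπ _ _ _ _).mpr (by rw [ha, hb, add_comm]))
    refine ⟨z, ?_, hz⟩
    have h1 := (hπ _ _ _ _).mp hp'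
    have h2 := (hπ _ _ _ _).mp (hQ.faces hz).2.1
    exact add_left_cancel (h1.trans h2.symm)
  have hself : ∀ a, d a a = 0 := fun a => by
    have h := hd.add (a := a) rfl rfl
    simpa using h
  obtain ⟨z, hz, hxz⟩ := hfill (hQ.faces hx).1 (hQ.faces hy).1 h₀ h₁ h₂
  obtain ⟨w, hw, hxw⟩ := hfill (hQ.faces hx).2.1 (hQ.faces hy).2.1 h₄ h₅ h₆
  have hyzw := hQ.memCube_trans (hQ.memCube_trans (hQ.memCube_symm hxz) hx) hxw
  have hvert := hQ.swap_first (hQ.memCube_trans_second (hQ.memCube_symm_second hy) hyzw)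
  have e1 := (hd.memCube_iff rfl hz rfl hw (hQ.faces hvert).1).mp hvert
  have e2 := (hd.memCube_iff h₀ h₁ h₂ (h₃.trans hz) (hQ.faces hx).1).mp hxz
  have e3 := (hd.memCube_iff h₄ h₅ h₆ (h₇.trans hw) (hQ.faces hx).2.1).mp hxw
  rw [hself, hself, zero_add, add_zero] at e1
  rw [← hd.add h₃ hz] at e2
  rw [← hd.add h₇ hw, e1] at e3
  linear_combination (norm := abel) e2 - e3

theorem mapCube_joinQuad (f : X → Y) (p q : Quad X) :
    mapCube f (joinQuad p q) = joinQuad (map4 f p) (map4 f q) := by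
  rw [eq_joinQuad (mapCube f (joinQuad p q))]
  rfl

theorem joinQuad_inj {p q p' q' : Quad X} : joinQuad p q = joinQuad p' q' ↔ p = p' ∧ q = q' :=
  ⟨fun h => ⟨congrArg (face · 0 false) h, congrArg (face · 0 true) h⟩,
    fun h => h.1 ▸ h.2 ▸ rfl⟩

/-- The affine cube in an abelian group with a given origin and given edge vectors. -/
def affineCube {B : Type} [AddCommGroup B] (b h k l : B) : Cube B :=
  joinQuad (b, b + l, b + k, b + k + l) (b + h, b + h + l, b + h + k, b + h + k + l)

theorem affineCube_inj {B : Type} [AddCommGroup B] {b h k l b' h' k' l' : B} :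
    affineCube b h k l = affineCube b' h' k' l' ↔ b = b' ∧ h = h' ∧ k = k' ∧ l = l' := by
  refine ⟨fun H => ?_, fun ⟨h₁, h₂, h₃, h₄⟩ => by rw [h₁, h₂, h₃, h₄]⟩
  simp only [affineCube, joinQuad_inj, Prod.mk.injEq] at H
  obtain ⟨⟨rfl, h₁, h₂, -⟩, h₃, -⟩ := H
  exact ⟨rfl, add_left_cancel h₃, add_left_cancel h₂, add_left_cancel h₁⟩

/-- The alternating sum of the entries of a cube. -/
def altSum {D : Type} [AddCommGroup D] (x : Cube D) : D :=
  x ![false, false, false] - x ![false, false, true] - x ![false, true, false]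
    + x ![false, true, true] - x ![true, false, false] + x ![true, false, true]
    + x ![true, true, false] - x ![true, true, true]

theorem altSum_add {D : Type} [AddCommGroup D] (x y : Cube D) :
    altSum (x + y) = altSum x + altSum y := by
  simp only [altSum, Pi.add_apply]
  abel

theorem altSum_neg {D : Type} [AddCommGroup D] (x : Cube D) : altSum (-x) = -altSum x := by
  simp only [altSum, Pi.neg_apply]
  abel

theorem altSum_eq_zero_of_isEdge3 {D : Type} [AddCommGroup D] {α : Set Vtx} (hα : IsEdge3 α)
    [∀ v, Decidable (v ∈ α)] (c : D) : altSum (fun v => if v ∈ α then c else 0) = 0 := by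
  obtain ⟨i, j, b, b', hij, rfl⟩ := hα
  fin_cases i <;> fin_cases j <;> cases b <;> cases b' <;> 
    first | exact absurd rfl hij | simp [altSum]

/-- The identities satisfied by the alternating sums over the cubes of a parallelepiped structure,
as functions of the origin and the edge vectors of the cube. -/
structure IsCubeCocycle {B D : Type} [AddCommGroup B] [AddCommGroup D]
    (ρ : B → B → B → B → D) : Prop where
  symm_first : ∀ b h k l, ρ b h k l = ρ b k h l
  symm_last : ∀ b h k l, ρ b h k l = ρ b h l k
  add : ∀ b h s k l, ρ b (h + s) k l = ρ b h k l + ρ (b + h) s k l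

/-- The cubes in `B × D` lying over affine cubes of `B`, with alternating sum prescribed by `ρ`. -/
def cocycleCubes {B D : Type} [AddCommGroup B] [AddCommGroup D] (ρ : B → B → B → B → D) :
    Set (Cube (B × D)) :=
  {y | ∃ b h k l, mapCube Prod.fst y = affineCube b h k l ∧
    altSum (mapCube Prod.snd y) = ρ b h k l}

/-- Strong parallelepiped structures are described by cocycles on their base. -/
theorem IsStrongParallelepiped.exists_cocycle [Nonempty X] {P : Set (Quad X)} {Q : Set (Cube X)}
    (hS : IsStrongParallelepiped P Q) :
    ∃ (B : Type) (_ : AddCommGroup B) (A : Type) (_ : AddCommGroup A) (π : X → B) (f : X → A)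
      (ρ : B → B → B → B → A),
      IsCubeCocycle ρ ∧ Function.Surjective π ∧ (∀ x y, π x = π y → f x = f y → x = y) ∧
      (∀ a b c d, (a, b, c, d) ∈ P ↔ π a + π d = π b + π c) ∧
      ∀ x, x ∈ Q ↔ mapCube (fun a => (π a, f a)) x ∈ cocycleCubes ρ := by
  obtain ⟨B, instB, π, hsurj, hπ⟩ := hS.1.1.exists_base
  obtain ⟨A, instA, d, hd⟩ := exists_isVerticalDifference hS π hπ
  have hQ := hS.1
  let f : X → A := fun x => d (Function.surjInv hsurj (π x)) x
  have hσ : ∀ b, π (Function.surjInv hsurj b) = b := Function.surjInv_eq hsurj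
  have hf : ∀ {x y}, π x = π y → f y - f x = d x y := by
    intro x y h
    have := hd.add (hσ (π x)) h
    simp only [f, ← h, ← this]
    abel
  have hinj : ∀ x y, π x = π y → f x = f y → x = y := by
    intro x y h h'
    simp only [f, ← h] at h'
    exact hd.inj (hσ _) ((hσ _).trans h) h'
  have hsum : ∀ {x y : Cube X}, x ∈ Q → y ∈ Q → mapCube π x = mapCube π y →
      altSum (mapCube f x) = altSum (mapCube f y) := by
    intro x y hx hy h
    rw [eq_joinQuad x] at hx
    rw [eq_joinQuad y] at hy
    have h' : ∀ v, π (x v) = π (y v) := congrFun h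
    have := hd.sum_eq_zero hQ hπ hx hy (h' _) (h' _) (h' _) (h' _) (h' _) (h' _) (h' _) (h' _)
    simp only [← hf (h' _)] at this
    change f (x ![false, false, false]) - f (x ![false, false, true])
      - f (x ![false, true, false]) + f (x ![false, true, true]) - f (x ![true, false, false])
      + f (x ![true, false, true]) + f (x ![true, true, false]) - f (x ![true, true, true])
      = f (y ![false, false, false]) - f (y ![false, false, true])
      - f (y ![false, true, false]) + f (y ![false, true, true]) - f (y ![true, false, false])
      + f (y ![true, false, true]) + f (y ![true, true, false]) - f (y ![true, true, true])
    change (f (y ![false, false, false]) - f (x ![false, false, false]))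
      - (f (y ![false, false, true]) - f (x ![false, false, true]))
      - (f (y ![false, true, false]) - f (x ![false, true, false]))
      + (f (y ![false, true, true]) - f (x ![false, true, true]))
      - (f (y ![true, false, false]) - f (x ![true, false, false]))
      + (f (y ![true, false, true]) - f (x ![true, false, true]))
      + (f (y ![true, true, false]) - f (x ![true, true, false]))
      - (f (y ![true, true, true]) - f (x ![true, true, true])) = 0 at this
    linear_combination (norm := abel) -this
  have haffine : ∀ {x : Cube X}, x ∈ Q → ∃ b h k l, mapCube π x = affineCube b h k l := by
    intro x hx
    rw [eq_joinQuad x] at hx ⊢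
    rw [mapCube_joinQuad]
    generalize face x 0 false = p, face x 0 true = q at hx
    obtain ⟨a, b, c, e⟩ := p
    obtain ⟨a', b', c', e'⟩ := q
    obtain ⟨h1, h2, h3, h4⟩ := hQ.faces hx
    rw [hπ] at h1 h2 h3 h4
    refine ⟨π a, π a' - π a, π c - π a, π b - π a, ?_⟩
    simp only [affineCube, joinQuad_inj, map4, Prod.mk.injEq]
    refine ⟨⟨trivial, ?_, ?_, ?_⟩, ?_, ?_, ?_, ?_⟩
    · abel
    · abel
    · linear_combination (norm := abel) h1
    · abel
    · linear_combination (norm := abel) h3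
    · linear_combination (norm := abel) h4
    · linear_combination (norm := abel) h2 + h3 + h4
  have hfill : ∀ {x₀ x₁ x₂ x₃ x₄ x₅ x₆ : X} {b h k l : B}, π x₀ = b → π x₁ = b + l →
      π x₂ = b + k → π x₃ = b + k + l → π x₄ = b + h → π x₅ = b + h + l → π x₆ = b + h + k →
      ∃ x₇, MemCube Q x₀ x₁ x₂ x₃ x₄ x₅ x₆ x₇ ∧ π x₇ = b + h + k + l := by
    intro x₀ x₁ x₂ x₃ x₄ x₅ x₆ b h k l h₀ h₁ h₂ h₃ h₄ h₅ h₆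
    obtain ⟨x₇, H⟩ := hQ.2.2.2.2.2.2 x₀ x₁ x₂ x₃ x₄ x₅ x₆
      ((hπ _ _ _ _).mpr (by rw [h₀, h₁, h₂, h₃]; abel))
      ((hπ _ _ _ _).mpr (by rw [h₀, h₂, h₄, h₆]; abel))
      ((hπ _ _ _ _).mpr (by rw [h₀, h₁, h₄, h₅]; abel))
    refine ⟨x₇, H, ?_⟩
    have := (hπ _ _ _ _).mp (hQ.faces H).2.1
    rw [h₄, h₅, h₆] at this
    linear_combination (norm := abel) this
  have hpoints : ∀ b h k l, ∃ x₀ x₁ x₂ x₃ x₄ x₅ x₆ x₇, MemCube Q x₀ x₁ x₂ x₃ x₄ x₅ x₆ x₇ ∧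
      π x₀ = b ∧ π x₁ = b + l ∧ π x₂ = b + k ∧ π x₃ = b + k + l ∧ π x₄ = b + h ∧
      π x₅ = b + h + l ∧ π x₆ = b + h + k ∧ π x₇ = b + h + k + l := by
    intro b h k l
    obtain ⟨x₇, H, h₇⟩ := hfill (hσ b) (hσ (b + l)) (hσ (b + k)) (hσ (b + k + l)) (hσ (b + h))
      (hσ (b + h + l)) (hσ (b + h + k))
    exact ⟨_, _, _, _, _, _, _, _, H, hσ _, hσ _, hσ _, hσ _, hσ _, hσ _, hσ _, h₇⟩
  have hexists : ∀ b h k l, ∃ x ∈ Q, mapCube π x = affineCube b h k l := by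
    intro b h k l
    obtain ⟨x₀, x₁, x₂, x₃, x₄, x₅, x₆, x₇, H, h₀, h₁, h₂, h₃, h₄, h₅, h₆, h₇⟩ := hpoints b h k l
    refine ⟨_, H, ?_⟩
    simp [mapCube_joinQuad, affineCube, map4, *]
  choose c hc hcπ using hexists
  let ρ : B → B → B → B → A := fun b h k l => altSum (mapCube f (c b h k l))
  have hρ : ∀ {x : Cube X} {b h k l}, x ∈ Q → mapCube π x = affineCube b h k l →
      altSum (mapCube f x) = ρ b h k l :=
    fun hx h => hsum hx (hc _ _ _ _) (h.trans (hcπ _ _ _ _).symm)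
  have hρ' : ∀ {x₀ x₁ x₂ x₃ x₄ x₅ x₆ x₇ : X} {b h k l : B}, MemCube Q x₀ x₁ x₂ x₃ x₄ x₅ x₆ x₇ →
      π x₀ = b → π x₁ = b + l → π x₂ = b + k → π x₃ = b + k + l → π x₄ = b + h →
      π x₅ = b + h + l → π x₆ = b + h + k → π x₇ = b + h + k + l →
      f x₀ - f x₁ - f x₂ + f x₃ - f x₄ + f x₅ + f x₆ - f x₇ = ρ b h k l := by
    intro x₀ x₁ x₂ x₃ x₄ x₅ x₆ x₇ b h k l H h₀ h₁ h₂ h₃ h₄ h₅ h₆ h₇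
    refine hρ H ?_
    simp [mapCube_joinQuad, affineCube, map4, *]
  refine ⟨B, instB, A, instA, π, f, ρ, ⟨?_, ?_, ?_⟩, hsurj, hinj, hπ, fun x => ⟨fun hx => ?_, ?_⟩⟩
  · intro b h k l
    obtain ⟨x₀, x₁, x₂, x₃, x₄, x₅, x₆, x₇, H, h₀, h₁, h₂, h₃, h₄, h₅, h₆, h₇⟩ := hpoints b h k l
    rw [← hρ' H h₀ h₁ h₂ h₃ h₄ h₅ h₆ h₇,
      ← hρ' (hQ.swap_first H) h₀ h₁ h₄ h₅ h₂ h₃ (h₆.trans (by abel)) (h₇.trans (by abel))]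
    abel
  · intro b h k l
    obtain ⟨x₀, x₁, x₂, x₃, x₄, x₅, x₆, x₇, H, h₀, h₁, h₂, h₃, h₄, h₅, h₆, h₇⟩ := hpoints b h k l
    rw [← hρ' H h₀ h₁ h₂ h₃ h₄ h₅ h₆ h₇,
      ← hρ' (hQ.swap_last H) h₀ h₂ h₁ (h₃.trans (by abel)) h₄ h₆ h₅ (h₇.trans (by abel))]
    abel
  · intro b h h' k l
    obtain ⟨x₀, x₁, x₂, x₃, x₄, x₅, x₆, x₇, H, h₀, h₁, h₂, h₃, h₄, h₅, h₆, h₇⟩ := hpoints b h k l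
    obtain ⟨y, H', hy⟩ := hfill h₄ h₅ h₆ h₇ (hσ (b + h + h')) (hσ (b + h + h' + l))
      (hσ (b + h + h' + k))
    rw [← hρ' H h₀ h₁ h₂ h₃ h₄ h₅ h₆ h₇,
      ← hρ' H' h₄ h₅ h₆ h₇ (hσ (b + h + h')) (hσ (b + h + h' + l)) (hσ (b + h + h' + k)) hy,
      ← hρ' (hQ.memCube_trans H H') h₀ h₁ h₂ h₃ (by rw [hσ]; abel) (by rw [hσ]; abel)
        (by rw [hσ]; abel) (by rw [hy]; abel)]
    abel
  · obtain ⟨b, h, k, l, H⟩ := haffine hx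
    exact ⟨b, h, k, l, H, hρ hx H⟩
  · rintro ⟨b, h, k, l, H, H'⟩
    change mapCube π x = _ at H
    change altSum (mapCube f x) = _ at H'
    rw [eq_joinQuad x] at H H' ⊢
    generalize face x 0 false = p, face x 0 true = q at H H'
    obtain ⟨x₀, x₁, x₂, x₃⟩ := p
    obtain ⟨x₄, x₅, x₆, x₇⟩ := q
    simp only [mapCube_joinQuad, affineCube, joinQuad_inj, map4, Prod.mk.injEq] at H
    obtain ⟨⟨h₀, h₁, h₂, h₃⟩, h₄, h₅, h₆, h₇⟩ := H
    obtain ⟨y, hy, hy'⟩ := hfill h₀ h₁ h₂ h₃ h₄ h₅ h₆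
    have h1 := hρ' hy h₀ h₁ h₂ h₃ h₄ h₅ h₆ hy'
    have h2 : f x₀ - f x₁ - f x₂ + f x₃ - f x₄ + f x₅ + f x₆ - f x₇ = ρ b h k l := H'
    rw [hinj x₇ y (h₇.trans hy'.symm) (sub_right_injective (h2.trans h1.symm))]
    exact hy

namespace IsCubeCocycle

variable {B D : Type} [AddCommGroup B] [AddCommGroup D] {ρ : B → B → B → B → D}

theorem apply_zero_first (hρ : IsCubeCocycle ρ) (b k l : B) : ρ b 0 k l = 0 := by
  simpa using hρ.add b 0 0 k l

theorem rotate (hρ : IsCubeCocycle ρ) (b h k l : B) : ρ b h k l = ρ b k l h := by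
  rw [hρ.symm_first, hρ.symm_last]

theorem add_mid (hρ : IsCubeCocycle ρ) (b h k k' l : B) :
    ρ b h (k + k') l = ρ b h k l + ρ (b + k) h k' l := by
  rw [hρ.symm_first b h, hρ.add, hρ.symm_first b h, hρ.symm_first (b + k) h]

theorem add_last (hρ : IsCubeCocycle ρ) (b h k s s' : B) :
    ρ b h k (s + s') = ρ b h k s + ρ (b + s) h k s' := by
  rw [hρ.rotate b h k (s + s'), hρ.rotate b k (s + s') h, hρ.add,
    hρ.rotate b h k s, hρ.rotate b k s h, hρ.rotate (b + s) h k s', hρ.rotate (b + s) k s' h]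

theorem apply_zero_last (hρ : IsCubeCocycle ρ) (b h k : B) : ρ b h k 0 = 0 := by
  rw [← hρ.rotate, hρ.apply_zero_first]

/-- The group of the transformations `(b, x) ↦ (b + s, x + φ b)` of `B × D` that map every
parallelogram to an equivalent one, for the structure with cubes `cocycleCubes ρ`. -/
def structureGroup (hρ : IsCubeCocycle ρ) : Subgroup (Equiv.Perm (B × D)) where
  carrier := {g | ∃ (s : B) (φ : B → D), (∀ y, g y = (y.1 + s, y.2 + φ y.1)) ∧
    ∀ b h k, φ b - φ (b + h) - φ (b + k) + φ (b + h + k) = -ρ b h k s}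
  mul_mem' := by
    rintro g g' ⟨s, φ, hg, hφ⟩ ⟨s', φ', hg', hφ'⟩
    refine ⟨s' + s, fun b => φ' b + φ (b + s'), fun y => ?_, fun b h k => ?_⟩
    · simp [hg, hg', add_assoc]
    · have h1 := hφ (b + s') h k
      have h2 := hρ.add_last b h k s' s
      rw [show b + s' + h = b + h + s' by abel, show b + s' + k = b + k + s' by abel,
        show b + h + s' + k = b + h + k + s' by abel] at h1
      beta_reduce
      linear_combination (norm := abel) h1 + hφ' b h k + h2
  one_mem' := by
    refine ⟨0, fun _ => 0, fun y => by simp, fun b h k => ?_⟩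
    simp [hρ.apply_zero_last]
  inv_mem' := by
    rintro g ⟨s, φ, hg, hφ⟩
    refine ⟨-s, fun b => -φ (b - s), fun y => ?_, fun b h k => ?_⟩
    · rw [Equiv.Perm.inv_eq_iff_eq, hg]
      ext <;> simp [sub_eq_add_neg]
    · have h1 := hφ (b - s) h k
      have h2 := hρ.add_last (b - s) h k s (-s)
      rw [add_neg_cancel, hρ.apply_zero_last, sub_add_cancel] at h2
      rw [show b - s + h = b + h - s by abel, show b - s + k = b + k - s by abel,
        show b + h - s + k = b + h + k - s by abel] at h1
      beta_reduce
      linear_combination (norm := abel) -h1 - h2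

variable (hρ : IsCubeCocycle ρ)

theorem exists_of_structureGroup (g : hρ.structureGroup) : ∃ (s : B) (φ : B → D),
    (∀ y, g.1 y = (y.1 + s, y.2 + φ y.1)) ∧
    ∀ b h k, φ b - φ (b + h) - φ (b + k) + φ (b + h + k) = -ρ b h k s :=
  g.2

/-- The transformation `(b, x) ↦ (b, x + c)`. -/
def vertical (c : D) : hρ.structureGroup :=
  ⟨Equiv.prodCongr (Equiv.refl B) (Equiv.addRight c), 0, fun _ => c,
    fun _ => Prod.ext (add_zero _).symm rfl, fun b h k => by simp [hρ.apply_zero_last]⟩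

theorem vertical_apply (c : D) (y : B × D) : (hρ.vertical c).1 y = (y.1, y.2 + c) := rfl

theorem vertical_add (c d : D) : hρ.vertical (c + d) = hρ.vertical c * hρ.vertical d := by
  refine Subtype.ext (Equiv.ext fun y => ?_)
  change (y.1, y.2 + (c + d)) = (y.1, y.2 + d + c)
  rw [add_comm c d, add_assoc]

theorem vertical_zero : hρ.vertical 0 = 1 :=
  Subtype.ext (Equiv.ext fun y => by simp [vertical_apply])

theorem vertical_comm (c : D) (g : hρ.structureGroup) :
    g * hρ.vertical c = hρ.vertical c * g := by
  obtain ⟨s, φ, hg, -⟩ := hρ.exists_of_structureGroup g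
  refine Subtype.ext (Equiv.ext fun y => ?_)
  change g.1 (y.1, y.2 + c) = ((g.1 y).1, (g.1 y).2 + c)
  rw [hg, hg]
  ext
  · rfl
  · exact add_right_comm _ _ _

/-- The translations along the fibers. -/
def verticalSubgroup : Subgroup hρ.structureGroup where
  carrier := Set.range hρ.vertical
  mul_mem' := by
    rintro _ _ ⟨c, rfl⟩ ⟨d, rfl⟩
    exact ⟨c + d, hρ.vertical_add c d⟩
  one_mem' := ⟨0, hρ.vertical_zero⟩
  inv_mem' := by
    rintro _ ⟨c, rfl⟩
    refine ⟨-c, eq_inv_of_mul_eq_one_left ?_⟩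
    rw [← hρ.vertical_add, neg_add_cancel, hρ.vertical_zero]

/-- The stabilizer of the origin in the structure group. -/
def originStabilizer : Subgroup hρ.structureGroup where
  carrier := {g | g.1 (0, 0) = (0, 0)}
  mul_mem' := fun {g g'} h h' => by
    change g.1 (g'.1 (0, 0)) = _
    rw [show g'.1 (0, 0) = (0, 0) from h', show g.1 (0, 0) = (0, 0) from h]
  one_mem' := rfl
  inv_mem' := fun {g} h => Equiv.Perm.inv_eq_iff_eq.mpr (Eq.symm h)

theorem commutator_le_verticalSubgroup :
    commutator hρ.structureGroup ≤ hρ.verticalSubgroup := by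
  rw [commutator_def, Subgroup.commutator_le]
  intro g _ g' _
  obtain ⟨s, φ, hg, hφ⟩ := hρ.exists_of_structureGroup g
  obtain ⟨t, ψ, hg', hψ⟩ := hρ.exists_of_structureGroup g'
  refine ⟨φ t - φ 0 - (ψ s - ψ 0), Eq.symm ?_⟩
  rw [commutatorElement_def, mul_inv_eq_iff_eq_mul, mul_inv_eq_iff_eq_mul]
  refine Subtype.ext (Equiv.ext fun y => ?_)
  change g.1 (g'.1 y) = ((g'.1 (g.1 y)).1, (g'.1 (g.1 y)).2 + (φ t - φ 0 - (ψ s - ψ 0)))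
  simp only [hg, hg']
  refine Prod.ext (add_right_comm _ _ _) ?_
  have h1 := hφ 0 y.1 t
  have h2 := hψ 0 y.1 s
  rw [hρ.symm_last] at h1
  simp only [zero_add] at h1 h2
  dsimp only
  linear_combination (norm := abel) h1 - h2

theorem verticalSubgroup_le_center :
    hρ.verticalSubgroup ≤ Subgroup.center hρ.structureGroup := by
  rintro _ ⟨c, rfl⟩
  exact Subgroup.mem_center_iff.mpr fun g => hρ.vertical_comm c g

theorem originStabilizer_inf_verticalSubgroup :
    hρ.originStabilizer ⊓ hρ.verticalSubgroup = ⊥ := by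
  rw [eq_bot_iff]
  rintro _ ⟨h, c, rfl⟩
  have h1 : ((0 : B), (0 : D) + c) = (0, 0) := h
  have h2 : c = 0 := by simpa using h1
  refine Subgroup.mem_bot.mpr (Subtype.ext (Equiv.ext fun y => ?_))
  rw [vertical_apply, h2, add_zero]
  rfl

/-- The orbit map of the origin. -/
def orbitMap (g : hρ.structureGroup) : B × D := g.1 (0, 0)

theorem orbitMap_eq_iff (g g' : hρ.structureGroup) :
    hρ.orbitMap g = hρ.orbitMap g' ↔ g⁻¹ * g' ∈ hρ.originStabilizer := by
  change g.1 (0, 0) = g'.1 (0, 0) ↔ g.1⁻¹ (g'.1 (0, 0)) = (0, 0)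
  rw [Equiv.Perm.inv_eq_iff_eq, eq_comm]

theorem apply_fst (g : hρ.structureGroup) (y : B × D) :
    (g.1 y).1 = y.1 + (hρ.orbitMap g).1 := by
  obtain ⟨s, φ, hg, -⟩ := hρ.exists_of_structureGroup g
  simp [orbitMap, hg]

theorem orbitMap_mul_fst (g g' : hρ.structureGroup) :
    (hρ.orbitMap (g * g')).1 = (hρ.orbitMap g).1 + (hρ.orbitMap g').1 := by
  change (g.1 (g'.1 (0, 0))).1 = _
  rw [apply_fst, add_comm]
  rfl

theorem orbitMap_mul_vertical (g : hρ.structureGroup) (c : D) :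
    hρ.orbitMap (g * hρ.vertical c) = ((hρ.orbitMap g).1, (hρ.orbitMap g).2 + c) := by
  rw [vertical_comm]
  rfl

theorem orbitMap_surjective
    (hD : ∀ (E : Type) [AddCommGroup E] (k : D →+ E), Function.Injective k →
      ∃ r : E →+ D, ∀ d, r (k d) = d) :
    Function.Surjective hρ.orbitMap := by
  rintro ⟨s, c⟩
  obtain ⟨φ, hφ⟩ := exists_second_difference hD (fun b h k => -ρ b h k s)
    (fun b h k => by rw [hρ.symm_first]) (fun b h h' k => by rw [hρ.add]; abel)
  let g : hρ.structureGroup := ⟨(Equiv.addRight s).prodShear fun b => Equiv.addRight (φ b), s, φ,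
    fun y => rfl, hφ⟩
  refine ⟨g * hρ.vertical (c - φ 0), ?_⟩
  rw [orbitMap_mul_vertical]
  change ((0 : B) + s, (0 : D) + φ 0 + (c - φ 0)) = (s, c)
  simp

theorem mem_image_quad_iff (hsurj : Function.Surjective hρ.orbitMap) (q : Quad (B × D)) :
    q ∈ map4 hρ.orbitMap '' ((edgeGroup2 hρ.structureGroup : Set (Quad hρ.structureGroup)) *
      (quadSub hρ.verticalSubgroup : Set (Quad hρ.structureGroup))) ↔
    q.1.1 + q.2.2.2.1 = q.2.1.1 + q.2.2.1.1 := by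
  let σ : hρ.structureGroup →* Multiplicative B :=
    MonoidHom.mk' (fun g => Multiplicative.ofAdd (hρ.orbitMap g).1) fun g g' =>
      congrArg Multiplicative.ofAdd (hρ.orbitMap_mul_fst g g')
  constructor
  · rintro ⟨_, ⟨k, hk, u, ⟨⟨c₀, h₀⟩, ⟨c₁, h₁⟩, ⟨c₂, h₂⟩, c₃, h₃⟩, rfl⟩, rfl⟩
    have hk' : σ k.1 * σ k.2.2.2 = σ k.2.1 * σ k.2.2.1 := by
      refine Subgroup.closure_induction (p := fun (k : Quad hρ.structureGroup) _ =>
        σ k.1 * σ k.2.2.2 = σ k.2.1 * σ k.2.2.1) ?_ ?_ ?_ ?_ hk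
      · rintro _ ⟨g, rfl | rfl | rfl⟩ <;> simp
      · rfl
      · intro k k' _ _ h h'
        simp only [Prod.fst_mul, Prod.snd_mul, map_mul]
        rw [mul_mul_mul_comm, h, h', mul_mul_mul_comm]
      · intro k _ h
        simp only [Prod.fst_inv, Prod.snd_inv, map_inv]
        rw [← mul_inv, h, mul_inv]
    simp only [map4, Prod.fst_mul, Prod.snd_mul, ← h₀, ← h₁, ← h₂, ← h₃, orbitMap_mul_vertical]
    exact hk'
  · obtain ⟨y₀, y₁, y₂, y₃⟩ := q
    intro h
    obtain ⟨g, hg⟩ := hsurj (y₃.1, 0)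
    obtain ⟨g₁, hg₁⟩ := hsurj (y₁.1 - y₃.1, 0)
    obtain ⟨g₂, hg₂⟩ := hsurj (y₂.1 - y₃.1, 0)
    have hmem : ∀ q : Quad hρ.structureGroup, (∃ g : hρ.structureGroup,
        q = (g, g, 1, 1) ∨ q = (g, 1, g, 1) ∨ q = (g, g, g, g)) →
        q ∈ edgeGroup2 hρ.structureGroup := fun q hq => Subgroup.subset_closure hq
    have hfill : ∀ (g : hρ.structureGroup) (y : B × D), (hρ.orbitMap g).1 = y.1 →
        hρ.orbitMap (g * hρ.vertical (y.2 - (hρ.orbitMap g).2)) = y := by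
      intro g y h
      rw [orbitMap_mul_vertical, h, add_sub_cancel]
    let k : Quad hρ.structureGroup := (g, g, g, g) * (g₁, g₁, 1, 1) * (g₂, 1, g₂, 1)
    refine ⟨_, ⟨k, mul_mem (mul_mem (hmem _ ⟨g, by simp⟩) (hmem _ ⟨g₁, by simp⟩))
      (hmem _ ⟨g₂, by simp⟩),
      (hρ.vertical (y₀.2 - (hρ.orbitMap k.1).2), hρ.vertical (y₁.2 - (hρ.orbitMap k.2.1).2),
        hρ.vertical (y₂.2 - (hρ.orbitMap k.2.2.1).2),
        hρ.vertical (y₃.2 - (hρ.orbitMap k.2.2.2).2)),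
      ⟨⟨_, rfl⟩, ⟨_, rfl⟩, ⟨_, rfl⟩, ⟨_, rfl⟩⟩, rfl⟩, ?_⟩
    refine Prod.ext (hfill _ _ ?_) (Prod.ext (hfill _ _ ?_) (Prod.ext (hfill _ _ ?_)
      (hfill _ _ ?_)))
    · simp only [k, Prod.mk_mul_mk, orbitMap_mul_fst, hg, hg₁, hg₂]
      linear_combination (norm := abel) -h
    · simp [k, orbitMap_mul_fst, hg, hg₁]
    · simp [k, orbitMap_mul_fst, hg, hg₂]
    · simp [k, hg]


theorem cubeElt_apply_mem_cocycleCubes (g : hρ.structureGroup) {α : Set Vtx} (hα : IsFace3 α)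
    {y : Cube (B × D)} (hy : y ∈ cocycleCubes ρ) :
    (fun v => (cubeElt α g v).1 (y v)) ∈ cocycleCubes ρ := by
  obtain ⟨i, c, rfl⟩ := hα
  obtain ⟨b, h, k, l, H, H'⟩ := hy
  obtain ⟨s, φ, hg, hφ⟩ := hρ.exists_of_structureGroup g
  rw [eq_joinQuad y] at H H' ⊢
  generalize face y 0 false = p, face y 0 true = q at H H'
  obtain ⟨⟨b₀, x₀⟩, ⟨b₁, x₁⟩, ⟨b₂, x₂⟩, b₃, x₃⟩ := p
  obtain ⟨⟨b₄, x₄⟩, ⟨b₅, x₅⟩, ⟨b₆, x₆⟩, b₇, x₇⟩ := q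
  simp only [mapCube_joinQuad, affineCube, joinQuad_inj, map4, Prod.mk.injEq] at H
  obtain ⟨⟨rfl, rfl, rfl, rfl⟩, rfl, rfl, rfl, rfl⟩ := H
  replace H' : x₀ - x₁ - x₂ + x₃ - x₄ + x₅ + x₆ - x₇ = ρ b₀ h k l := H'
  have key : ∀ {b₀ b₁ b₂ b₃ b₄ b₅ b₆ b₇ : B} {x₀ x₁ x₂ x₃ x₄ x₅ x₆ x₇ : D} (b h k l : B),
      b₀ = b → b₁ = b + l → b₂ = b + k → b₃ = b + k + l → b₄ = b + h → b₅ = b + h + l →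
      b₆ = b + h + k → b₇ = b + h + k + l →
      x₀ - x₁ - x₂ + x₃ - x₄ + x₅ + x₆ - x₇ = ρ b h k l →
      joinQuad ((b₀, x₀), (b₁, x₁), (b₂, x₂), b₃, x₃) ((b₄, x₄), (b₅, x₅), (b₆, x₆), b₇, x₇) ∈
        cocycleCubes ρ := by
    rintro b _ _ _ _ _ _ _ x₀ x₁ x₂ x₃ x₄ x₅ x₆ x₇ _ h k l rfl rfl rfl rfl rfl rfl rfl rfl hx
    exact ⟨b, h, k, l, by rw [mapCube_joinQuad]; rfl, hx⟩
  rw [eq_joinQuad fun v => _]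
  fin_cases i <;> cases c <;> simp [face, insert3, joinQuad, quadAt, cubeElt, hg]
  · refine key (b₀ + s) (h - s) k l ?_ ?_ ?_ ?_ ?_ ?_ ?_ ?_ ?sum
    case sum =>
      have h1 := hφ b₀ k l
      have h2 := hρ.add b₀ s (h - s) k l
      rw [add_sub_cancel, hρ.rotate b₀ s k l] at h2
      linear_combination (norm := abel) H' + h1 + h2
    all_goals abel
  · refine key b₀ (h + s) k l ?_ ?_ ?_ ?_ ?_ ?_ ?_ ?_ ?sum
    case sum =>
      have h1 := hφ (b₀ + h) k l
      have h2 := hρ.add b₀ h s k l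
      rw [hρ.rotate (b₀ + h) s k l] at h2
      linear_combination (norm := abel) H' - h1 - h2
    all_goals abel
  · refine key (b₀ + s) h (k - s) l ?_ ?_ ?_ ?_ ?_ ?_ ?_ ?_ ?sum
    case sum =>
      have h1 := hφ b₀ h l
      have h2 := hρ.add_mid b₀ h s (k - s) l
      rw [add_sub_cancel, hρ.symm_last b₀ h s l] at h2
      linear_combination (norm := abel) H' + h1 + h2
    all_goals abel
  · refine key b₀ h (k + s) l ?_ ?_ ?_ ?_ ?_ ?_ ?_ ?_ ?sum
    case sum =>
      have h1 := hφ (b₀ + k) h l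
      have h2 := hρ.add_mid b₀ h k s l
      rw [add_right_comm b₀ k h] at h1
      rw [hρ.symm_last (b₀ + k) h s l] at h2
      linear_combination (norm := abel) H' - h1 - h2
    all_goals abel
  · refine key (b₀ + s) h k (l - s) ?_ ?_ ?_ ?_ ?_ ?_ ?_ ?_ ?sum
    case sum =>
      have h1 := hφ b₀ h k
      have h2 := hρ.add_last b₀ h k s (l - s)
      rw [add_sub_cancel] at h2
      linear_combination (norm := abel) H' + h1 + h2
    all_goals abel
  · refine key b₀ h k (l + s) ?_ ?_ ?_ ?_ ?_ ?_ ?_ ?_ ?sum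
    case sum =>
      have h1 := hφ (b₀ + l) h k
      have h2 := hρ.add_last b₀ h k l s
      rw [add_right_comm b₀ l h, add_right_comm b₀ l k, add_right_comm (b₀ + h) l k] at h1
      linear_combination (norm := abel) H' - h1 - h2
    all_goals abel

theorem smul_mem_cocycleCubes {k : Cube hρ.structureGroup} (hk : k ∈ faceGroup hρ.structureGroup)
    {y : Cube (B × D)} (hy : y ∈ cocycleCubes ρ) : (fun v => (k v).1 (y v)) ∈ cocycleCubes ρ := by
  have hgen : ∀ (g : hρ.structureGroup) (α : Set Vtx),
      (cubeElt α g)⁻¹ = cubeElt α g⁻¹ := by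
    intro g α
    funext v
    simp only [cubeElt, Pi.inv_apply, apply_ite Inv.inv, inv_one]
  induction hk using Subgroup.closure_induction'' generalizing y with
  | mem x hx =>
    obtain ⟨g, α, hα, rfl⟩ := hx
    exact hρ.cubeElt_apply_mem_cocycleCubes g hα hy
  | inv_mem x hx =>
    obtain ⟨g, α, hα, rfl⟩ := hx
    rw [hgen]
    exact hρ.cubeElt_apply_mem_cocycleCubes g⁻¹ hα hy
  | one => exact hy
  | mul k k' _ _ ih ih' => exact ih (ih' hy)

theorem zero_mem_cocycleCubes (hρ : IsCubeCocycle ρ) :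
    (fun _ => (0, 0) : Cube (B × D)) ∈ cocycleCubes ρ := by
  refine ⟨0, 0, 0, 0, ?_, ?_⟩
  · rw [eq_joinQuad (mapCube _ _)]
    simp [affineCube, face, mapCube]
  · simp [altSum, mapCube, hρ.apply_zero_last]

theorem exists_of_mem_edgeGroup3 {u : Cube hρ.structureGroup}
    (hu : u ∈ edgeGroup3 hρ.verticalSubgroup) :
    ∃ w : Cube D, altSum w = 0 ∧ u = fun v => hρ.vertical (w v) := by
  classical
  induction hu using Subgroup.closure_induction with
  | mem u hu =>
    obtain ⟨_, ⟨c, rfl⟩, α, hα, rfl⟩ := hu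
    refine ⟨fun v => if v ∈ α then c else 0, altSum_eq_zero_of_isEdge3 hα c, funext fun v => ?_⟩
    by_cases hv : v ∈ α <;> simp [cubeElt, hv, vertical_zero]
  | one => exact ⟨0, by simp [altSum], funext fun v => hρ.vertical_zero.symm⟩
  | mul u u' _ _ ih ih' =>
    obtain ⟨w, hw, rfl⟩ := ih
    obtain ⟨w', hw', rfl⟩ := ih'
    exact ⟨w + w', by rw [altSum_add, hw, hw', add_zero],
      funext fun v => (hρ.vertical_add _ _).symm⟩
  | inv u _ ih =>
    obtain ⟨w, hw, rfl⟩ := ih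
    refine ⟨-w, by rw [altSum_neg, hw, neg_zero], funext fun v => inv_eq_of_mul_eq_one_right ?_⟩
    rw [← hρ.vertical_add]
    simpa using hρ.vertical_zero

theorem vertical_mem_edgeGroup3 {w : Cube D} (hw : altSum w = 0) :
    (fun v => hρ.vertical (w v)) ∈ edgeGroup3 hρ.verticalSubgroup := by
  have hedge : ∀ (i j : Fin 3) (b c : Bool) (d : D), i ≠ j →
      (fun v : Vtx => hρ.vertical (if v i = b ∧ v j = c then d else 0)) ∈
        edgeGroup3 hρ.verticalSubgroup := by
    intro i j b c d hij
    refine Subgroup.subset_closure ⟨hρ.vertical d, ⟨d, rfl⟩, {v | v i = b ∧ v j = c},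
      ⟨i, j, b, c, hij, rfl⟩, funext fun v => ?_⟩
    by_cases hv : v i = b ∧ v j = c <;> simp [cubeElt, hv, vertical_zero]
  have hadd : ∀ {w w' : Cube D}, (fun v => hρ.vertical (w v)) ∈ edgeGroup3 hρ.verticalSubgroup →
      (fun v => hρ.vertical (w' v)) ∈ edgeGroup3 hρ.verticalSubgroup →
      (fun v => hρ.vertical ((w + w') v)) ∈ edgeGroup3 hρ.verticalSubgroup := by
    intro w w' h h'
    convert mul_mem h h' using 1
    exact funext fun v => hρ.vertical_add _ _
  let c₁ := w ![false, false, false]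
  let c₂ := w ![false, false, true] - c₁
  let c₃ := w ![false, true, true] - c₂
  let c₄ := w ![false, true, false] - c₃
  let c₅ := w ![true, true, false] - c₄
  let c₆ := w ![true, true, true] - c₅
  let c₇ := w ![true, false, true] - c₆
  convert hadd (hadd (hadd (hadd (hadd (hadd
    (hedge 0 1 false false c₁ (by decide)) (hedge 0 2 false true c₂ (by decide)))
    (hedge 0 1 false true c₃ (by decide))) (hedge 1 2 true false c₄ (by decide)))
    (hedge 0 1 true true c₅ (by decide))) (hedge 0 2 true true c₆ (by decide)))
    (hedge 0 1 true false c₇ (by decide)) using 4 with v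
  have hv : v = ![v 0, v 1, v 2] := by
    ext i
    fin_cases i <;> rfl
  have h₇ : w ![true, false, false] = c₇ := by
    rw [altSum] at hw
    simp only [c₁, c₂, c₃, c₄, c₅, c₆, c₇]
    linear_combination (norm := abel) -hw
  rw [hv]
  generalize v 0 = a₀, v 1 = a₁, v 2 = a₂
  cases a₀ <;> cases a₁ <;> cases a₂ <;> simp [h₇] <;> simp [c₁, c₂, c₃, c₄, c₅, c₆, c₇]

theorem mem_image_cube_iff (hsurj : Function.Surjective hρ.orbitMap) (y : Cube (B × D)) :
    y ∈ mapCube hρ.orbitMap '' ((faceGroup hρ.structureGroup : Set (Cube hρ.structureGroup)) *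
      (edgeGroup3 hρ.verticalSubgroup : Set (Cube hρ.structureGroup))) ↔ y ∈ cocycleCubes ρ := by
  constructor
  · rintro ⟨_, ⟨k, hk, u, hu, rfl⟩, rfl⟩
    obtain ⟨w, hw, rfl⟩ := hρ.exists_of_mem_edgeGroup3 hu
    obtain ⟨b, h, k', l, H, H'⟩ := hρ.smul_mem_cocycleCubes hk hρ.zero_mem_cocycleCubes
    have hy : mapCube hρ.orbitMap (k * fun v => hρ.vertical (w v)) =
        fun v => ((hρ.orbitMap (k v)).1, (hρ.orbitMap (k v)).2 + w v) :=
      funext fun v => hρ.orbitMap_mul_vertical _ _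
    refine ⟨b, h, k', l, ?_, ?_⟩
    · change mapCube Prod.fst (mapCube hρ.orbitMap (k * fun v => hρ.vertical (w v))) = _
      rw [hy]
      exact H
    · change altSum (mapCube Prod.snd (mapCube hρ.orbitMap (k * fun v => hρ.vertical (w v)))) = _
      rw [hy]
      refine (altSum_add _ w).trans ?_
      rw [hw, add_zero]
      exact H'
  · rintro ⟨b, h, k, l, H, H'⟩
    obtain ⟨g₀, h₀⟩ := hsurj (b, 0)
    obtain ⟨g₁, h₁⟩ := hsurj (h, 0)
    obtain ⟨g₂, h₂⟩ := hsurj (k, 0)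
    obtain ⟨g₃, h₃⟩ := hsurj (l, 0)
    have hface : ∀ (g : hρ.structureGroup) (i : Fin 3) (c : Bool),
        cubeElt {v | v i = c} g ∈ faceGroup hρ.structureGroup :=
      fun g i c => Subgroup.subset_closure ⟨g, _, ⟨i, c, rfl⟩, rfl⟩
    let κ : Cube hρ.structureGroup := cubeElt {v | v 0 = false} g₀ * cubeElt {v | v 0 = true} g₀ *
      cubeElt {v | v 0 = true} g₁ * cubeElt {v | v 1 = true} g₂ * cubeElt {v | v 2 = true} g₃
    have hκ : κ ∈ faceGroup hρ.structureGroup :=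
      mul_mem (mul_mem (mul_mem (mul_mem (hface _ _ _) (hface _ _ _)) (hface _ _ _))
        (hface _ _ _)) (hface _ _ _)
    obtain ⟨b', h', k', l', K, K'⟩ := hρ.smul_mem_cocycleCubes hκ hρ.zero_mem_cocycleCubes
    have hbase : mapCube Prod.fst (mapCube hρ.orbitMap κ) = affineCube b h k l := by
      rw [eq_joinQuad (mapCube _ _), affineCube, joinQuad_inj]
      simp [face, insert3, mapCube, κ, cubeElt, orbitMap_mul_fst, h₀, h₁, h₂, h₃]
    obtain ⟨rfl, rfl, rfl, rfl⟩ := affineCube_inj.mp (K.symm.trans hbase)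
    have hw : altSum (mapCube Prod.snd y + -mapCube Prod.snd (mapCube hρ.orbitMap κ)) = 0 := by
      rw [altSum_add, altSum_neg, H', add_neg_eq_zero]
      exact K'.symm
    refine ⟨_, ⟨κ, hκ, _, hρ.vertical_mem_edgeGroup3 hw, rfl⟩, funext fun v => ?_⟩
    refine (hρ.orbitMap_mul_vertical _ _).trans (Prod.ext (congrFun (hbase.trans H.symm) v) ?_)
    simp [mapCube]

/-- The coordinatewise images under the orbit map form a nilparallelepiped structure. -/
theorem isNilStructure_image (hsurj : Function.Surjective hρ.orbitMap) :
    IsNilStructure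
      (map4 hρ.orbitMap '' ((edgeGroup2 hρ.structureGroup : Set (Quad hρ.structureGroup)) *
        (quadSub hρ.verticalSubgroup : Set (Quad hρ.structureGroup))))
      (mapCube hρ.orbitMap '' ((faceGroup hρ.structureGroup : Set (Cube hρ.structureGroup)) *
        (edgeGroup3 hρ.verticalSubgroup : Set (Cube hρ.structureGroup)))) :=
  ⟨hρ.structureGroup, inferInstance, hρ.verticalSubgroup, hρ.originStabilizer, hρ.orbitMap,
    hρ.commutator_le_verticalSubgroup, hρ.verticalSubgroup_le_center,
    hρ.originStabilizer_inf_verticalSubgroup, hsurj, hρ.orbitMap_eq_iff, rfl, rfl⟩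

theorem map {A : Type} [AddCommGroup A] {ρ : B → B → B → B → A} (hρ : IsCubeCocycle ρ)
    (j : A →+ D) : IsCubeCocycle fun b h k l => j (ρ b h k l) where
  symm_first b h k l := congrArg j (hρ.symm_first b h k l)
  symm_last b h k l := congrArg j (hρ.symm_last b h k l)
  add b h h' k l := by rw [hρ.add, map_add]

end IsCubeCocycle

theorem mem_cocycleCubes_map_iff {B A D : Type} [AddCommGroup B] [AddCommGroup A]
    [AddCommGroup D] {ρ : B → B → B → B → A} {j : A →+ D} (hj : Function.Injective j)
    (y : Cube (B × A)) :
    mapCube (Prod.map id j) y ∈ cocycleCubes (fun b h k l => j (ρ b h k l)) ↔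
      y ∈ cocycleCubes ρ := by
  have hsum : altSum (mapCube Prod.snd (mapCube (Prod.map id j) y)) =
      j (altSum (mapCube Prod.snd y)) := by
    simp only [altSum, map_add, map_sub]
    rfl
  simp only [cocycleCubes, Set.mem_ofPred_eq, hsum, hj.eq_iff]
  rfl

/-- Every strong parallelepiped structure can be embedded in a
nilparallelepiped structure: there are a nilparallelepiped structure `(PY, QY)` on a set `Y`
and an injection `ι : X → Y` such that `P` and `Q` are the coordinatewise preimages of `PY`
and `QY`, and the composition of `ι` with the projection of `Y` onto its base is onto
(every `y ∈ Y` lies in the same fiber, `⟨ι x, y⟩ = 1`, as some `ι x`). -/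
theorem embeds_in_nilstructure (X : Type) [Nonempty X]
    (P : Set (Quad X)) (Q : Set (Cube X)) (h : IsStrongParallelepiped P Q) :
    ∃ (Y : Type) (PY : Set (Quad Y)) (QY : Set (Cube Y)) (ι : X → Y),
      IsNilStructure PY QY ∧ Function.Injective ι ∧
      P = map4 ι ⁻¹' PY ∧ Q = mapCube ι ⁻¹' QY ∧
      (∀ y : Y, ∃ x : X, (ι x, y, y, y) ∈ PY) := by
  obtain ⟨B, _, A, _, π, f, ρ₀, hρ₀, hπ, hinj, hP, hQ⟩ := h.exists_cocycle
  obtain ⟨D, _, j, hj, hD⟩ := exists_embedding_split A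
  have hρ := hρ₀.map j
  have hsurj := hρ.orbitMap_surjective hD
  refine ⟨B × D, _, _, fun a => (π a, j (f a)), hρ.isNilStructure_image hsurj, ?_, ?_, ?_, ?_⟩
  · intro a b hab
    exact hinj a b (congrArg Prod.fst hab) (hj (congrArg Prod.snd hab))
  · ext ⟨a, b, c, d⟩
    rw [hP, Set.mem_preimage, hρ.mem_image_quad_iff hsurj]
    rfl
  · ext x
    rw [hQ, Set.mem_preimage, hρ.mem_image_cube_iff hsurj, ← mem_cocycleCubes_map_iff hj]
    rfl
  · intro y
    obtain ⟨x, hx⟩ := hπ y.1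
    refine ⟨x, (hρ.mem_image_quad_iff hsurj _).mpr ?_⟩
    simp [hx]

end HK
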